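/- Let (X, M, *) be a fuzzy metric space satisfying the attainment property, let T : X → Ĉ₀(X) be a (1)-Kannan contraction with constant c ∈ (0,1), let t₀ > 1, and let (x_n)_{n≥0} be a sequence in X such that x_{n+1} ∈ T x_n and M(x_n, x_{n+1}, t) ≥ Θ(T x_{n−1}, T x_n, t) for all n ≥ 1 and all t > 0. If (x_n) converges to a point z ∈ X, then 𝓜(z, Tz, t) > 1 − t for every t > 0. -/

import Mathlib

open Set Filter Topology

/-- A continuous t-norm: a binary operation on `[0,1]` (modeled as a real-valued
operation whose behavior is specified on `Icc 0 1`) that is associative, commutative,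
continuous, has `1` as unit, and is monotone in both arguments. -/
structure ContinuousTNorm where
  mul : ℝ → ℝ → ℝ
  mul_mem : ∀ a b : ℝ, a ∈ Icc (0:ℝ) 1 → b ∈ Icc (0:ℝ) 1 → mul a b ∈ Icc (0:ℝ) 1
  mul_assoc : ∀ a b c : ℝ, a ∈ Icc (0:ℝ) 1 → b ∈ Icc (0:ℝ) 1 → c ∈ Icc (0:ℝ) 1 →
    mul (mul a b) c = mul a (mul b c)
  mul_comm : ∀ a b : ℝ, a ∈ Icc (0:ℝ) 1 → b ∈ Icc (0:ℝ) 1 → mul a b = mul b a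
  continuousOn : ContinuousOn (fun p : ℝ × ℝ => mul p.1 p.2) (Icc (0:ℝ) 1 ×ˢ Icc (0:ℝ) 1)
  mul_one : ∀ a : ℝ, a ∈ Icc (0:ℝ) 1 → mul a 1 = a
  mul_mono : ∀ a b c d : ℝ, a ∈ Icc (0:ℝ) 1 → b ∈ Icc (0:ℝ) 1 → c ∈ Icc (0:ℝ) 1 →
    d ∈ Icc (0:ℝ) 1 → a ≤ c → b ≤ d → mul a b ≤ mul c d

/-- A fuzzy metric (in the sense of George–Veeramani) on `X` with respect to the
continuous t-norm `star`. -/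
structure FuzzyMetric (X : Type*) (star : ContinuousTNorm) where
  M : X → X → ℝ → ℝ
  pos : ∀ x y t, 0 < t → 0 < M x y t
  le_one : ∀ x y t, 0 < t → M x y t ≤ 1
  eq_iff : ∀ x y, (∀ t, 0 < t → M x y t = 1) ↔ x = y
  symm : ∀ x y t, 0 < t → M x y t = M y x t
  triangle : ∀ x y z t s, 0 < t → 0 < s →
    star.mul (M x y t) (M y z s) ≤ M x z (t + s)
  continuousOn : ∀ x y, ContinuousOn (M x y) (Ioi (0:ℝ))

/-- The fuzzy distance `𝓜(ρ, A, t) = sup { M(ρ, μ, t) : μ ∈ A }`. -/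
noncomputable def fuzzyDist {X : Type*} {star : ContinuousTNorm} (F : FuzzyMetric X star)
    (ρ : X) (A : Set X) (t : ℝ) : ℝ :=
  sSup ((fun μ => F.M ρ μ t) '' A)

/-- The Hausdorff fuzzy distance
`Θ(A, B, t) = min { inf_{ρ∈A} 𝓜(ρ, B, t), inf_{μ∈B} 𝓜(A, μ, t) }`. -/
noncomputable def hausdorffFuzzyDist {X : Type*} {star : ContinuousTNorm} (F : FuzzyMetric X star)
    (A B : Set X) (t : ℝ) : ℝ :=
  min (sInf ((fun ρ => fuzzyDist F ρ B t) '' A))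
      (sInf ((fun μ => fuzzyDist F μ A t) '' B))

/-- The topology on `X` generated by the open balls
`B(x, r, t) = { y | M(x, y, t) > 1 - r }` for `x ∈ X`, `r ∈ (0,1)`, `t > 0`. -/
def ballTopology {X : Type*} {star : ContinuousTNorm} (F : FuzzyMetric X star) :
    TopologicalSpace X :=
  TopologicalSpace.generateFrom
    { s : Set X | ∃ x : X, ∃ r t : ℝ, 0 < r ∧ r < 1 ∧ 0 < t ∧
        s = { y : X | 1 - r < F.M x y t } }

/-- `T : X → Set X` (with nonempty compact values) is a (1)-Kannan contraction
with constant `c ∈ (0,1)`. -/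
def IsKannanContraction {X : Type*} {star : ContinuousTNorm} (F : FuzzyMetric X star)
    (T : X → Set X) (c : ℝ) : Prop :=
  ∀ x y : X, ∀ t : ℝ, 0 < t →
    1 - t < min (fuzzyDist F x (T x) t) (fuzzyDist F y (T y) t) →
    1 - c * t < hausdorffFuzzyDist F (T x) (T y) (c * t)

/-- A sequence converges to `z` in the fuzzy metric sense. -/
def FuzzyConvergesTo {X : Type*} {star : ContinuousTNorm} (F : FuzzyMetric X star)
    (x : ℕ → X) (z : X) : Prop :=
  ∀ t : ℝ, 0 < t → Tendsto (fun n => F.M (x n) z t) atTop (𝓝 1)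

/-- A sequence is G-Cauchy. -/
def IsGCauchy {X : Type*} {star : ContinuousTNorm} (F : FuzzyMetric X star)
    (x : ℕ → X) : Prop :=
  ∀ t : ℝ, 0 < t → ∀ q : ℕ, Tendsto (fun n => F.M (x n) (x (n + q)) t) atTop (𝓝 1)

/-- Attainment property: for every `ρ`, nonempty compact `B`, and `t > 0`, the sup
defining `𝓜(ρ, B, t)` is attained at some `μ ∈ B`. -/
def AttainmentProperty {X : Type*} {star : ContinuousTNorm} (F : FuzzyMetric X star) : Prop :=
  ∀ (ρ : X) (B : Set X), B.Nonempty → (@IsCompact X (ballTopology F) B) →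
    ∀ t : ℝ, 0 < t → ∃ μ ∈ B, fuzzyDist F ρ B t = F.M ρ μ t

section FuzzyMetricLemmas

variable {X : Type*} {star : ContinuousTNorm} (F : FuzzyMetric X star)

theorem FuzzyMetric.M_mem_Icc (x y : X) {t : ℝ} (ht : 0 < t) : F.M x y t ∈ Icc (0 : ℝ) 1 :=
  ⟨(F.pos x y t ht).le, F.le_one x y t ht⟩

theorem le_fuzzyDist (ρ : X) {A : Set X} {μ : X} (hμ : μ ∈ A) {t : ℝ} (ht : 0 < t) :
    F.M ρ μ t ≤ fuzzyDist F ρ A t := by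
  refine le_csSup ⟨1, ?_⟩ (mem_image_of_mem _ hμ)
  rintro _ ⟨ν, -, rfl⟩
  exact F.le_one ρ ν t ht

theorem fuzzyDist_pos (ρ : X) {A : Set X} (hA : A.Nonempty) {t : ℝ} (ht : 0 < t) :
    0 < fuzzyDist F ρ A t :=
  (F.pos ρ hA.some t ht).trans_le (le_fuzzyDist F ρ hA.some_mem ht)

theorem exists_lt_of_lt_fuzzyDist {ρ : X} {A : Set X} (hA : A.Nonempty) {a t : ℝ}
    (h : a < fuzzyDist F ρ A t) : ∃ μ ∈ A, a < F.M ρ μ t := by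
  obtain ⟨_, ⟨μ, hμ, rfl⟩, h⟩ := exists_lt_of_lt_csSup (hA.image _) h
  exact ⟨μ, hμ, h⟩

theorem hausdorffFuzzyDist_le_fuzzyDist {A B : Set X} (hB : B.Nonempty) {ρ : X} (hρ : ρ ∈ A)
    {t : ℝ} (ht : 0 < t) : hausdorffFuzzyDist F A B t ≤ fuzzyDist F ρ B t := by
  refine (min_le_left _ _).trans (csInf_le ⟨0, ?_⟩ (mem_image_of_mem _ hρ))
  rintro _ ⟨ν, -, rfl⟩
  exact (fuzzyDist_pos F ν hB ht).le

/-- Multiplying a fixed element of `[0,1]` by a net tending to `1` gives a net tending to it. -/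
theorem ContinuousTNorm.tendsto_mul_of_tendsto_one (star : ContinuousTNorm) {ι : Type*}
    {l : Filter ι} {u : ι → ℝ} (hu : Tendsto u l (𝓝 1)) (hmem : ∀ i, u i ∈ Icc (0 : ℝ) 1)
    {b : ℝ} (hb : b ∈ Icc (0 : ℝ) 1) : Tendsto (fun i => star.mul (u i) b) l (𝓝 b) := by
  have h1 : (1 : ℝ) ∈ Icc (0 : ℝ) 1 := ⟨zero_le_one, le_rfl⟩
  have hcont := star.continuousOn (1, b) ⟨h1, hb⟩
  have hpair : Tendsto (fun i => (u i, b)) l (𝓝[Icc (0 : ℝ) 1 ×ˢ Icc (0 : ℝ) 1] (1, b)) :=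
    tendsto_nhdsWithin_iff.2
      ⟨hu.prodMk_nhds tendsto_const_nhds, Eventually.of_forall fun i => ⟨hmem i, hb⟩⟩
  have := hcont.tendsto.comp hpair
  rwa [star.mul_comm 1 b h1 hb, star.mul_one b hb] at this

/-- If the points `x n` converge to `z` and frequently lie at fuzzy distance more than `a` from `A`
at scale `s`, then `z` lies at fuzzy distance at least `a` from `A` at every larger scale. -/
theorem le_fuzzyDist_of_fuzzyConvergesTo {x : ℕ → X} {z : X} (hz : FuzzyConvergesTo F x z)
    {A : Set X} (hA : A.Nonempty) {a s r : ℝ} (hs : 0 < s) (hsr : s < r)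
    (h : ∃ᶠ n in atTop, a < fuzzyDist F (x n) A s) : a ≤ fuzzyDist F z A r := by
  have hr : 0 < r - s := sub_pos.2 hsr
  rcases lt_or_ge a 0 with ha | ha
  · exact ha.le.trans (fuzzyDist_pos F z hA (hs.trans hsr)).le
  have ha1 : a ≤ 1 := by
    obtain ⟨n, hn⟩ := h.exists
    obtain ⟨μ, -, hμ⟩ := exists_lt_of_lt_fuzzyDist F hA hn
    exact hμ.le.trans (F.le_one _ _ _ hs)
  have hlim := star.tendsto_mul_of_tendsto_one (hz (r - s) hr)
    (fun n => F.M_mem_Icc (x n) z hr) ⟨ha, ha1⟩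
  refine le_of_tendsto_of_frequently hlim (h.mono fun n hn => ?_)
  obtain ⟨μ, hμA, hμ⟩ := exists_lt_of_lt_fuzzyDist F hA hn
  have htri := F.triangle z (x n) μ (r - s) s hr hs
  rw [F.symm z (x n) _ hr, sub_add_cancel] at htri
  exact ((star.mul_mono _ _ _ _ (F.M_mem_Icc _ _ hr) ⟨ha, ha1⟩ (F.M_mem_Icc _ _ hr)
    (F.M_mem_Icc _ _ hs) le_rfl hμ.le).trans htri).trans
    (le_fuzzyDist F z hμA (hs.trans hsr))

/-- Along an orbit of a (1)-Kannan contraction, the fuzzy distance from `x m` to `T (x m)` exceeds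
`1 - s` as soon as `s > c ^ n` for some `n ≤ m`. -/
theorem IsKannanContraction.lt_fuzzyDist_orbit {F : FuzzyMetric X star} {T : X → Set X} {c : ℝ}
    (hK : IsKannanContraction F T c) (hTne : ∀ x, (T x).Nonempty) (hc : 0 < c) {x : ℕ → X}
    (hx : ∀ n, x (n + 1) ∈ T (x n)) (n : ℕ) :
    ∀ m, n ≤ m → ∀ s, c ^ n < s → 1 - s < fuzzyDist F (x m) (T (x m)) s := by
  induction n with
  | zero =>
    intro m _ s hs
    rw [pow_zero] at hs
    linarith [fuzzyDist_pos F (x m) (hTne (x m)) (zero_lt_one.trans hs)]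
  | succ n ih =>
    intro m hm s hs
    obtain ⟨k, rfl⟩ : ∃ k, m = k + 1 := ⟨m - 1, by omega⟩
    have hs0 : 0 < s := (pow_pos hc _).trans hs
    have hlt : c ^ n < s / c := by rwa [lt_div_iff₀ hc, ← pow_succ]
    have h := hK (x k) (x (k + 1)) (s / c) (div_pos hs0 hc)
      (lt_min (ih k (by omega) _ hlt) (ih (k + 1) (by omega) _ hlt))
    rw [mul_div_cancel₀ s hc.ne'] at h
    exact h.trans_le (hausdorffFuzzyDist_le_fuzzyDist F (hTne _) (hx k) hs0)

end FuzzyMetricLemmas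

/-- If `(X, M, *)` satisfies the attainment property, `T` is a (1)-Kannan contraction
with constant `c ∈ (0,1)`, `t₀ > 1`, and `(x_n)` is a sequence with `x_{n+1} ∈ T x_n`
and `M(x_n, x_{n+1}, t) ≥ Θ(T x_{n-1}, T x_n, t)` for `n ≥ 1` that converges to `z`,
then `𝓜(z, Tz, t) > 1 - t` for every `t > 0`. -/
theorem limit_fuzzyDist_estimate {X : Type*} {star : ContinuousTNorm}
    (F : FuzzyMetric X star) (hatt : AttainmentProperty F)
    (T : X → Set X)
    (hTne : ∀ x : X, (T x).Nonempty)
    (hTcpt : ∀ x : X, @IsCompact X (ballTopology F) (T x))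
    (c : ℝ) (hc : c ∈ Set.Ioo (0 : ℝ) 1) (hK : IsKannanContraction F T c)
    (t₀ : ℝ) (ht₀ : 1 < t₀)
    (x : ℕ → X) (hx : ∀ n : ℕ, x (n + 1) ∈ T (x n))
    (hxM : ∀ n : ℕ, ∀ t : ℝ, 0 < t →
      hausdorffFuzzyDist F (T (x n)) (T (x (n + 1))) t ≤ F.M (x (n + 1)) (x (n + 2)) t)
    (z : X) (hz : FuzzyConvergesTo F x z) :
    ∀ t : ℝ, 0 < t → 1 - t < fuzzyDist F z (T z) t := by
  obtain ⟨hc0, hc1⟩ := hc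
  have hstep : ∀ t r : ℝ, 0 < t → c * t < r → 1 - t < fuzzyDist F z (T z) t →
      1 - r < fuzzyDist F z (T z) r := by
    intro t r ht hr hzt
    have hct : 0 < c * t := mul_pos hc0 ht
    obtain ⟨N, hN⟩ := exists_pow_lt_of_lt_one ht hc1
    have hev : ∀ᶠ n in atTop, 1 - c * t < fuzzyDist F (x n) (T z) (c * t) := by
      filter_upwards [eventually_ge_atTop (N + 1)] with m hm
      obtain ⟨k, rfl⟩ : ∃ k, m = k + 1 := ⟨m - 1, by omega⟩
      exact (hK (x k) z t ht
        (lt_min (hK.lt_fuzzyDist_orbit hTne hc0 hx N k (by omega) t hN) hzt)).trans_le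
        (hausdorffFuzzyDist_le_fuzzyDist F (hTne z) (hx k) hct)
    linarith [le_fuzzyDist_of_fuzzyConvergesTo F hz (hTne z) hct hr hev.frequently]
  have hpow : ∀ n : ℕ, ∀ t : ℝ, c ^ n < t → 1 - t < fuzzyDist F z (T z) t := by
    intro n
    induction n with
    | zero =>
      intro t ht
      rw [pow_zero] at ht
      linarith [fuzzyDist_pos F z (hTne z) (zero_lt_one.trans ht)]
    | succ n ih =>
      intro t ht
      have hlt : c ^ n < t / c := by rwa [lt_div_iff₀ hc0, ← pow_succ]
      obtain ⟨s, hs, hst⟩ := exists_between hlt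
      refine hstep s t ((pow_pos hc0 n).trans hs) ?_ (ih s hs)
      rwa [lt_div_iff₀ hc0, mul_comm] at hst
  intro t ht
  obtain ⟨n, hn⟩ := exists_pow_lt_of_lt_one ht hc1
  exact hpow n t hn
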